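/- (Reciprocity of the two-layer Green's function) Suppose G assigns to each y ∈ ℝ² with y₂ ≠ 0 a locally integrable function G(·, y) : ℝ² → ℂ that is a distributional solution of ΔG(·,y) + κ₀²G(·,y) = −δ_y, has the standard logarithmic singularity at y, is source-regular at y, and satisfies the two-layer radiation decay. Then G(x, z) = G(z, x) for all x, z ∈ ℝ² with x₂ ≠ 0, z₂ ≠ 0 and x ≠ z. -/

import Mathlib

noncomputable section
open MeasureTheory Real Filter Topology

/-- Points of the plane ℝ². -/
abbrev Pt : Type := EuclideanSpace ℝ (Fin 2)

/-- The point with coordinates (a, b). -/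
def pt (a b : ℝ) : Pt := (WithLp.equiv 2 (Fin 2 → ℝ)).symm ![a, b]

/-- The point ρ·(cos θ, sin θ) on the circle of radius ρ. -/
def ptc (ρ θ : ℝ) : Pt := pt (ρ * Real.cos θ) (ρ * Real.sin θ)

/-- The Laplacian of a complex-valued function on ℝ². -/
def lap (u : Pt → ℂ) (x : Pt) : ℂ :=
  fderiv ℝ (fun y => fderiv ℝ u y (pt 1 0)) x (pt 1 0) +
  fderiv ℝ (fun y => fderiv ℝ u y (pt 0 1)) x (pt 0 1)

/-- Radial (outward normal) derivative on a circle centered at the origin: ∇F(ξ)·(ξ/|ξ|). -/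
def dnu (F : Pt → ℂ) (ξ : Pt) : ℂ := fderiv ℝ F ξ ((‖ξ‖⁻¹ : ℝ) • ξ)

/-- Integral over the circle ∂B_ρ: ∫₀^{2π} F(ρ cos θ, ρ sin θ) ρ dθ (complex valued). -/
def circInt (ρ : ℝ) (F : Pt → ℂ) : ℂ := ∫ θ in (0:ℝ)..(2 * π), F (ptc ρ θ) * (ρ : ℂ)

/-- Integral over the circle ∂B_ρ: ∫₀^{2π} F(ρ cos θ, ρ sin θ) ρ dθ (real valued). -/
def circIntR (ρ : ℝ) (F : Pt → ℝ) : ℝ := ∫ θ in (0:ℝ)..(2 * π), F (ptc ρ θ) * ρ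

/-- The background two-layer wavenumber κ₀ : equal to κ₁ on {x₂ > 0} and κ₂ on {x₂ ≤ 0}. -/
def kappa0 (κ1 κ2 : ℝ) (x : Pt) : ℝ := if 0 < x 1 then κ1 else κ2

/-- w is a distributional solution of Δw + κ₀²w = −δ_y. -/
def IsPointSourceSol (κ1 κ2 : ℝ) (w : Pt → ℂ) (y : Pt) : Prop :=
  ∀ φ : Pt → ℂ, ContDiff ℝ (⊤ : ℕ∞) φ → HasCompactSupport φ →
    (∫ ξ : Pt, w ξ * (lap φ ξ + ((kappa0 κ1 κ2 ξ : ℝ) : ℂ) ^ 2 * φ ξ)) = -φ y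

/-- w has the standard logarithmic singularity −(1/2π) log|ξ − y| at y. -/
def HasLogSingularity (w : Pt → ℂ) (y : Pt) : Prop :=
  ∃ U : Set Pt, IsOpen U ∧ y ∈ U ∧ ∃ h : Pt → ℂ, ContDiffOn ℝ 1 h U ∧
    ∀ ξ ∈ U \ {y}, w ξ = -(((1 / (2 * π) : ℝ)) : ℂ) * (Real.log ‖ξ - y‖ : ℂ) + h ξ

/-- w is source-regular at y: C¹ off the source point, C² off the interface and source point. -/
def SourceRegular (w : Pt → ℂ) (y : Pt) : Prop :=
  ContDiffOn ℝ 1 w {y}ᶜ ∧ ContDiffOn ℝ 2 w ({x : Pt | 0 < x 1} \ {y}) ∧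
    ContDiffOn ℝ 2 w ({x : Pt | x 1 < 0} \ {y})

/-- w satisfies the two-layer radiation decay. -/
def RadiationDecay (κ1 κ2 : ℝ) (w : Pt → ℂ) : Prop :=
  ∃ C > (0:ℝ), ∃ ρ₀ > (0:ℝ), ∀ ξ : Pt, ρ₀ ≤ ‖ξ‖ →
    ‖w ξ‖ ≤ C * ‖ξ‖ ^ (-(1/2) : ℝ) ∧
    ‖dnu w ξ - Complex.I * ((kappa0 κ1 κ2 ξ : ℝ) : ℂ) * w ξ‖ ≤ C * ‖ξ‖ ^ (-(3/2) : ℝ)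

open scoped Convolution

/-- The bilinear dot product `∇f · ∇g`. -/
def gradDot (f g : Pt → ℂ) (ξ : Pt) : ℂ :=
  fderiv ℝ f ξ (pt 1 0) * fderiv ℝ g ξ (pt 1 0) + fderiv ℝ f ξ (pt 0 1) * fderiv ℝ g ξ (pt 0 1)

theorem continuous_mul_of_tsupport_subset {Ω : Set Pt} (hΩ : IsOpen Ω) {w g : Pt → ℂ}
    (hw : ContinuousOn w Ω) (hg : Continuous g) (hgΩ : tsupport g ⊆ Ω) :
    Continuous (fun ξ => w ξ * g ξ) :=
  (hw.mul hg.continuousOn).continuous_of_tsupport_subset hΩ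
    ((tsupport_mul_subset_right (f := w) (g := g)).trans hgΩ)

theorem integrable_mul_of_tsupport_subset {Ω : Set Pt} (hΩ : IsOpen Ω) {w g : Pt → ℂ}
    (hw : ContinuousOn w Ω) (hg : Continuous g) (hgc : HasCompactSupport g)
    (hgΩ : tsupport g ⊆ Ω) : Integrable (fun ξ => w ξ * g ξ) :=
  (continuous_mul_of_tsupport_subset hΩ hw hg hgΩ).integrable_of_hasCompactSupport hgc.mul_left

theorem continuousOn_fderiv_apply_of_contDiffOn {Ω : Set Pt} (hΩ : IsOpen Ω) {w : Pt → ℂ}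
    (hw : ContDiffOn ℝ 1 w Ω) (e : Pt) : ContinuousOn (fun ξ => fderiv ℝ w ξ e) Ω :=
  (hw.continuousOn_fderiv_of_isOpen hΩ le_rfl).clm_apply continuousOn_const

theorem differentiableAt_of_contDiffOn {Ω : Set Pt} (hΩ : IsOpen Ω) {w : Pt → ℂ}
    (hw : ContDiffOn ℝ 1 w Ω) {ξ : Pt} (hξ : ξ ∈ Ω) : DifferentiableAt ℝ w ξ :=
  (hw.contDiffAt (hΩ.mem_nhds hξ)).differentiableAt one_ne_zero

theorem continuous_fderiv_apply_of_contDiff {g : Pt → ℂ} (hg : ContDiff ℝ 1 g) (e : Pt) :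
    Continuous (fun ξ => fderiv ℝ g ξ e) :=
  (hg.continuous_fderiv one_ne_zero).clm_apply continuous_const

/-- Integration by parts against a compactly supported factor. -/
theorem integral_mul_fderiv_of_tsupport_subset {Ω : Set Pt} (hΩ : IsOpen Ω) {w g : Pt → ℂ}
    (hw : ContDiffOn ℝ 1 w Ω) (hg : ContDiff ℝ 1 g) (hgc : HasCompactSupport g)
    (hgΩ : tsupport g ⊆ Ω) (e : Pt) :
    ∫ ξ, w ξ * fderiv ℝ g ξ e = -∫ ξ, fderiv ℝ w ξ e * g ξ :=
  integral_mul_fderiv_eq_neg_fderiv_mul_of_integrable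
    (integrable_mul_of_tsupport_subset hΩ (continuousOn_fderiv_apply_of_contDiffOn hΩ hw e)
      hg.continuous hgc hgΩ)
    (integrable_mul_of_tsupport_subset hΩ hw.continuousOn
      (continuous_fderiv_apply_of_contDiff hg e) (hgc.fderiv_apply ℝ e)
      ((tsupport_fderiv_apply_subset ℝ e).trans hgΩ))
    (integrable_mul_of_tsupport_subset hΩ hw.continuousOn hg.continuous hgc hgΩ)
    (fun _ hξ => differentiableAt_of_contDiffOn hΩ hw (hgΩ hξ))
    (fun _ _ => hg.differentiable one_ne_zero _)

theorem integrable_fderiv_mul_fderiv {Ω : Set Pt} (hΩ : IsOpen Ω) {w g : Pt → ℂ}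
    (hw : ContDiffOn ℝ 1 w Ω) (hg : ContDiff ℝ 1 g) (hgc : HasCompactSupport g)
    (hgΩ : tsupport g ⊆ Ω) (e : Pt) :
    Integrable (fun ξ => fderiv ℝ w ξ e * fderiv ℝ g ξ e) :=
  integrable_mul_of_tsupport_subset hΩ (continuousOn_fderiv_apply_of_contDiffOn hΩ hw e)
    (continuous_fderiv_apply_of_contDiff hg e) (hgc.fderiv_apply ℝ e)
    ((tsupport_fderiv_apply_subset ℝ e).trans hgΩ)

theorem integrable_gradDot {Ω : Set Pt} (hΩ : IsOpen Ω) {w g : Pt → ℂ}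
    (hw : ContDiffOn ℝ 1 w Ω) (hg : ContDiff ℝ 1 g) (hgc : HasCompactSupport g)
    (hgΩ : tsupport g ⊆ Ω) : Integrable (gradDot w g) :=
  (integrable_fderiv_mul_fderiv hΩ hw hg hgc hgΩ _).add
    (integrable_fderiv_mul_fderiv hΩ hw hg hgc hgΩ _)

theorem contDiff_fderiv_apply {n : ℕ} {g : Pt → ℂ} (hg : ContDiff ℝ (n + 1) g) (e : Pt) :
    ContDiff ℝ n (fun ξ => fderiv ℝ g ξ e) :=
  (hg.fderiv_right le_rfl).clm_apply contDiff_const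

theorem continuous_lap {g : Pt → ℂ} (hg : ContDiff ℝ 2 g) : Continuous (lap g) := by
  have h : ∀ e, ContDiff ℝ 1 (fun ξ => fderiv ℝ g ξ e) := fun e =>
    contDiff_fderiv_apply (n := 1) hg e
  exact (continuous_fderiv_apply_of_contDiff (h _) _).add
    (continuous_fderiv_apply_of_contDiff (h _) _)

theorem tsupport_lap_subset (g : Pt → ℂ) : tsupport (lap g) ⊆ tsupport g := by
  refine (tsupport_add _ _).trans (Set.union_subset ?_ ?_) <;>
  exact (tsupport_fderiv_apply_subset ℝ _).trans (tsupport_fderiv_apply_subset ℝ _)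

theorem integral_mul_lap {Ω : Set Pt} (hΩ : IsOpen Ω) {w g : Pt → ℂ}
    (hw : ContDiffOn ℝ 1 w Ω) (hg : ContDiff ℝ 2 g) (hgc : HasCompactSupport g)
    (hgΩ : ∀ e, tsupport (fun ξ => fderiv ℝ g ξ e) ⊆ Ω) :
    ∫ ξ, w ξ * lap g ξ = -∫ ξ, gradDot w g ξ := by
  have h : ∀ e, ContDiff ℝ 1 (fun ξ => fderiv ℝ g ξ e) := fun e =>
    contDiff_fderiv_apply (n := 1) hg e
  have hc : ∀ e, HasCompactSupport (fun ξ => fderiv ℝ g ξ e) := fun e => hgc.fderiv_apply ℝ e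
  have hi : ∀ e, Integrable (fun ξ => w ξ * fderiv ℝ (fun ξ => fderiv ℝ g ξ e) ξ e) := fun e =>
    integrable_mul_of_tsupport_subset hΩ hw.continuousOn
      (continuous_fderiv_apply_of_contDiff (h e) e) ((hc e).fderiv_apply ℝ e)
      ((tsupport_fderiv_apply_subset ℝ e).trans (hgΩ e))
  have hj : ∀ e, Integrable (fun ξ => fderiv ℝ w ξ e * fderiv ℝ g ξ e) := fun e =>
    integrable_mul_of_tsupport_subset hΩ (continuousOn_fderiv_apply_of_contDiffOn hΩ hw e)
      (h e).continuous (hc e) (hgΩ e)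
  simp only [lap, gradDot, mul_add]
  rw [integral_add (hi _) (hi _), integral_add (hj _) (hj _),
    integral_mul_fderiv_of_tsupport_subset hΩ hw (h _) (hc _) (hgΩ _),
    integral_mul_fderiv_of_tsupport_subset hΩ hw (h _) (hc _) (hgΩ _), neg_add]

/-- Mollification of a compactly supported `C¹` function. -/
theorem exists_smooth_approx {Ω : Set Pt} (hΩ : IsOpen Ω) {f : Pt → ℂ} (hf : ContDiff ℝ 1 f)
    (hfc : HasCompactSupport f) (hfΩ : tsupport f ⊆ Ω) :
    ∃ (φ : ℕ → Pt → ℂ) (K : Set Pt) (M : ℝ), IsCompact K ∧ K ⊆ Ω ∧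
      (∀ n, ContDiff ℝ (⊤ : ℕ∞) (φ n)) ∧ (∀ n, tsupport (φ n) ⊆ K) ∧
      (∀ n ξ, ‖φ n ξ‖ ≤ M) ∧ (∀ n ξ, ‖fderiv ℝ (φ n) ξ‖ ≤ M) ∧
      (∀ ξ, Tendsto (fun n => φ n ξ) atTop (𝓝 (f ξ))) ∧
      (∀ ξ, Tendsto (fun n => fderiv ℝ (φ n) ξ) atTop (𝓝 (fderiv ℝ f ξ))) := by
  obtain ⟨δ, hδ, hδΩ⟩ := hfc.isCompact.exists_cthickening_subset_open hΩ hfΩ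
  have hpos : ∀ n : ℕ, 0 < δ / (n + 2) := fun n => by positivity
  let b : ℕ → ContDiffBump (0 : Pt) := fun n =>
    ⟨δ / (n + 2) / 2, δ / (n + 2), half_pos (hpos n), half_lt_self (hpos n)⟩
  have hb : Tendsto (fun n => (b n).rOut) atTop (𝓝 0) := by
    have : Tendsto (fun n : ℕ => (n : ℝ) + 2) atTop atTop :=
      tendsto_atTop_add_const_right _ _ tendsto_natCast_atTop_atTop
    exact this.const_div_atTop δ
  have hbδ : ∀ n, (b n).rOut ≤ δ := fun n => by
    change δ / (n + 2) ≤ δ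
    exact div_le_self hδ.le (by linarith [(Nat.cast_nonneg n : (0 : ℝ) ≤ n)])
  let φ : ℕ → Pt → ℂ := fun n => ((b n).normed volume) ⋆[ContinuousLinearMap.lsmul ℝ ℝ, volume] f
  have hL : (ContinuousLinearMap.lsmul ℝ ℝ : ℝ →L[ℝ] ℂ →L[ℝ] ℂ).precompR Pt
      = ContinuousLinearMap.lsmul ℝ ℝ := by
    ext; simp
  have hloc : ∀ n, LocallyIntegrable ((b n).normed volume) (volume : Measure Pt) := fun n =>
    (b n).continuous_normed.locallyIntegrable
  have hφ' : ∀ n ξ, fderiv ℝ (φ n) ξ =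
      (((b n).normed volume) ⋆[ContinuousLinearMap.lsmul ℝ ℝ, volume] fderiv ℝ f) ξ := by
    intro n ξ
    have := (hfc.hasFDerivAt_convolution_right
      (ContinuousLinearMap.lsmul ℝ ℝ : ℝ →L[ℝ] ℂ →L[ℝ] ℂ) (hloc n) hf ξ).fderiv
    rw [hL] at this
    exact this
  have hf'c : Continuous (fderiv ℝ f) := hf.continuous_fderiv one_ne_zero
  obtain ⟨M₀, hM₀⟩ := hfc.exists_bound_of_continuous hf.continuous
  obtain ⟨M₁, hM₁⟩ := (hfc.fderiv ℝ).exists_bound_of_continuous hf'c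
  refine ⟨φ, Metric.cthickening δ (tsupport f), 3 * max M₀ M₁, hfc.isCompact.cthickening, hδΩ,
    ?_, ?_, ?_, ?_, ?_, ?_⟩
  · intro n
    exact (b n).hasCompactSupport_normed.contDiff_convolution_left _ (b n).contDiff_normed
      hf.continuous.locallyIntegrable
  · intro n
    refine closure_minimal ?_ Metric.isClosed_cthickening
    refine (support_convolution_subset _).trans ?_
    rintro _ ⟨s, hs, t, ht, rfl⟩
    rw [(b n).support_normed_eq, mem_ball_zero_iff] at hs
    refine Metric.mem_cthickening_of_dist_le _ t _ _ (subset_tsupport f ht) ?_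
    simpa [dist_eq_norm] using hs.le.trans (hbδ n)
  · intro n ξ
    have h1 := (b n).dist_normed_convolution_le (x₀ := ξ) (ε := 2 * max M₀ M₁)
      (μ := (volume : Measure Pt)) hf.continuous.aestronglyMeasurable (fun x _ => by
        rw [dist_eq_norm]
        linarith [norm_sub_le (f x) (f ξ), hM₀ x, hM₀ ξ, le_max_left M₀ M₁])
    rw [dist_eq_norm] at h1
    have h2 := norm_sub_norm_le (φ n ξ) (f ξ)
    linarith [hM₀ ξ, le_max_left M₀ M₁]
  · intro n ξ
    have h1 := (b n).dist_normed_convolution_le (x₀ := ξ) (ε := 2 * max M₀ M₁)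
      (μ := (volume : Measure Pt)) hf'c.aestronglyMeasurable (fun x _ => by
        rw [dist_eq_norm]
        linarith [norm_sub_le (fderiv ℝ f x) (fderiv ℝ f ξ), hM₁ x, hM₁ ξ, le_max_right M₀ M₁])
    rw [dist_eq_norm, ← hφ'] at h1
    have h2 := norm_sub_norm_le (fderiv ℝ (φ n) ξ) (fderiv ℝ f ξ)
    linarith [hM₁ ξ, le_max_right M₀ M₁]
  · exact fun ξ => ContDiffBump.convolution_tendsto_right_of_continuous hb hf.continuous ξ
  · intro ξ
    simp only [hφ']
    exact ContDiffBump.convolution_tendsto_right_of_continuous hb hf'c ξ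

theorem tendsto_integral_mul_of_tendsto {w : Pt → ℂ} {g : ℕ → Pt → ℂ} {g₀ : Pt → ℂ} {K : Set Pt}
    {M : ℝ} (hK : IsCompact K) (hw : ContinuousOn w K) (hi : ∀ n, Integrable (fun ξ => w ξ * g n ξ))
    (hg0 : ∀ n, ∀ ξ ∉ K, g n ξ = 0) (hM : ∀ n ξ, ‖g n ξ‖ ≤ M)
    (hlim : ∀ ξ, Tendsto (fun n => g n ξ) atTop (𝓝 (g₀ ξ))) :
    Tendsto (fun n => ∫ ξ, w ξ * g n ξ) atTop (𝓝 (∫ ξ, w ξ * g₀ ξ)) := by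
  refine tendsto_integral_of_dominated_convergence (K.indicator fun ξ => ‖w ξ‖ * M)
    (fun n => (hi n).aestronglyMeasurable) ?_ (fun n => ae_of_all _ fun ξ => ?_)
    (ae_of_all _ fun ξ => (hlim ξ).const_mul _)
  · rw [integrable_indicator_iff hK.measurableSet]
    exact (hw.norm.mul continuousOn_const).integrableOn_compact hK
  · by_cases hξ : ξ ∈ K
    · rw [Set.indicator_of_mem hξ, norm_mul]
      exact mul_le_mul_of_nonneg_left (hM n ξ) (norm_nonneg _)
    · rw [Set.indicator_of_notMem hξ, hg0 n ξ hξ, mul_zero, norm_zero]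

/-- A `C¹` distributional solution of `Δw + qw = 0` satisfies the weak formulation for
compactly supported `C¹` test functions. -/
theorem integral_gradDot_eq_of_distributional {Ω : Set Pt} (hΩ : IsOpen Ω) {w q : Pt → ℂ}
    (hw : ContDiffOn ℝ 1 w Ω) (hq : Measurable q) {B : ℝ} (hB : ∀ ξ, ‖q ξ‖ ≤ B)
    (hsol : ∀ φ : Pt → ℂ, ContDiff ℝ (⊤ : ℕ∞) φ → HasCompactSupport φ → tsupport φ ⊆ Ω →
      ∫ ξ, w ξ * (lap φ ξ + q ξ * φ ξ) = 0)
    {f : Pt → ℂ} (hf : ContDiff ℝ 1 f) (hfc : HasCompactSupport f) (hfΩ : tsupport f ⊆ Ω) :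
    ∫ ξ, gradDot w f ξ = ∫ ξ, q ξ * (w ξ * f ξ) := by
  obtain ⟨φ, K, M, hK, hKΩ, hφ, hφK, hφM, hφM', hlim, hlim'⟩ := exists_smooth_approx hΩ hf hfc hfΩ
  have hc : ∀ n, HasCompactSupport (φ n) := fun n =>
    hK.of_isClosed_subset (isClosed_tsupport _) (hφK n)
  have hΩn : ∀ n, tsupport (φ n) ⊆ Ω := fun n => (hφK n).trans hKΩ
  have h1 : ∀ n, ContDiff ℝ 1 (φ n) := fun n => contDiff_infty.1 (hφ n) 1
  have h2 : ∀ n, ContDiff ℝ 2 (φ n) := fun n => contDiff_infty.1 (hφ n) 2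
  have hwφ : ∀ n, Integrable (fun ξ => w ξ * φ n ξ) := fun n =>
    integrable_mul_of_tsupport_subset hΩ hw.continuousOn (h1 n).continuous (hc n) (hΩn n)
  have hqi : ∀ {g : Pt → ℂ}, Integrable g → Integrable (fun ξ => q ξ * g ξ) := fun hg =>
    hg.bdd_mul hq.aestronglyMeasurable (ae_of_all _ hB)
  have hD : ∀ e, Tendsto (fun n => ∫ ξ, fderiv ℝ w ξ e * fderiv ℝ (φ n) ξ e) atTop
      (𝓝 (∫ ξ, fderiv ℝ w ξ e * fderiv ℝ f ξ e)) := fun e =>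
    tendsto_integral_mul_of_tendsto (M := M * ‖e‖) hK
      ((continuousOn_fderiv_apply_of_contDiffOn hΩ hw e).mono hKΩ)
      (fun n => integrable_fderiv_mul_fderiv hΩ hw (h1 n) (hc n) (hΩn n) e)
      (fun n ξ hξ => image_eq_zero_of_notMem_tsupport
        (f := fun ξ => fderiv ℝ (φ n) ξ e) fun h => hξ (hφK n (tsupport_fderiv_apply_subset ℝ e h)))
      (fun n ξ => (ContinuousLinearMap.le_opNorm _ _).trans
        (mul_le_mul_of_nonneg_right (hφM' n ξ) (norm_nonneg _)))
      (fun ξ => ((ContinuousLinearMap.apply ℝ ℂ e).continuous.tendsto _).comp (hlim' ξ))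
  have hgrad : Tendsto (fun n => ∫ ξ, gradDot w (φ n) ξ) atTop (𝓝 (∫ ξ, gradDot w f ξ)) := by
    simp only [gradDot]
    rw [integral_add (integrable_fderiv_mul_fderiv hΩ hw hf hfc hfΩ _)
      (integrable_fderiv_mul_fderiv hΩ hw hf hfc hfΩ _)]
    refine ((hD _).add (hD _)).congr fun n => ?_
    rw [integral_add (integrable_fderiv_mul_fderiv hΩ hw (h1 n) (hc n) (hΩn n) _)
      (integrable_fderiv_mul_fderiv hΩ hw (h1 n) (hc n) (hΩn n) _)]
  have hmass : Tendsto (fun n => ∫ ξ, q ξ * (w ξ * φ n ξ)) atTop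
      (𝓝 (∫ ξ, q ξ * (w ξ * f ξ))) := by
    have hcomm : ∀ g : Pt → ℂ, (fun ξ => q ξ * (w ξ * g ξ)) = fun ξ => w ξ * (q ξ * g ξ) :=
      fun g => funext fun ξ => by ring
    simp only [hcomm]
    refine tendsto_integral_mul_of_tendsto (M := B * M) hK (hw.continuousOn.mono hKΩ)
      (fun n => by rw [← hcomm]; exact hqi (hwφ n)) (fun n ξ hξ => ?_) (fun n ξ => ?_)
      (fun ξ => (hlim ξ).const_mul _)
    · rw [image_eq_zero_of_notMem_tsupport fun h => hξ (hφK n h), mul_zero]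
    · rw [norm_mul]
      exact mul_le_mul (hB ξ) (hφM n ξ) (norm_nonneg _) ((norm_nonneg _).trans (hB ξ))
  refine tendsto_nhds_unique hgrad (hmass.congr fun n => ?_)
  have h := hsol (φ n) (hφ n) (hc n) (hΩn n)
  have hsplit : ∀ ξ, w ξ * (lap (φ n) ξ + q ξ * φ n ξ)
      = w ξ * lap (φ n) ξ + q ξ * (w ξ * φ n ξ) := fun ξ => by ring
  simp only [hsplit] at h
  rw [integral_add (integrable_mul_of_tsupport_subset hΩ hw.continuousOn (continuous_lap (h2 n))
      ((hc n).of_isClosed_subset (isClosed_tsupport _) (tsupport_lap_subset _))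
      ((tsupport_lap_subset _).trans (hΩn n))) (hqi (hwφ n)),
    integral_mul_lap hΩ hw (h2 n) (hc n)
      (fun e => (tsupport_fderiv_apply_subset ℝ e).trans (hΩn n))] at h
  linear_combination h

theorem gradDot_mul {f g h : Pt → ℂ} {ξ : Pt} (hg : DifferentiableAt ℝ g ξ)
    (hh : DifferentiableAt ℝ h ξ) :
    gradDot f (fun ξ => g ξ * h ξ) ξ = g ξ * gradDot f h ξ + h ξ * gradDot f g ξ := by
  simp only [gradDot, fderiv_fun_mul hg hh, add_apply,
    smul_apply, smul_eq_mul]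
  ring

theorem gradDot_comm (f g : Pt → ℂ) (ξ : Pt) : gradDot f g ξ = gradDot g f ξ := by
  simp only [gradDot, mul_comm]

theorem gradDot_eq_zero_of_notMem_tsupport {f g : Pt → ℂ} {ξ : Pt} (hξ : ξ ∉ tsupport g) :
    gradDot f g ξ = 0 := by
  have h : fderiv ℝ g ξ = 0 :=
    image_eq_zero_of_notMem_tsupport fun h => hξ (tsupport_fderiv_subset ℝ h)
  simp [gradDot, h]

/-- The pairing of the field `v∇u - u∇v` with `∇ψ`. -/
def flux (u v ψ : Pt → ℂ) : ℂ := ∫ ξ, (v ξ * gradDot u ψ ξ - u ξ * gradDot v ψ ξ)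

theorem flux_swap (u v ψ : Pt → ℂ) : flux v u ψ = -flux u v ψ := by
  rw [flux, flux, ← integral_neg]
  simp only [neg_sub]

theorem contDiff_mul_of_tsupport_subset {Ω : Set Pt} (hΩ : IsOpen Ω) {w g : Pt → ℂ}
    (hw : ContDiffOn ℝ 1 w Ω) (hg : ContDiff ℝ 1 g) (hgΩ : tsupport g ⊆ Ω) :
    ContDiff ℝ 1 (fun ξ => w ξ * g ξ) :=
  contDiff_iff_contDiffAt.2 fun ξ => by
    by_cases hξ : ξ ∈ tsupport g
    · exact (hw.contDiffAt (hΩ.mem_nhds (hgΩ hξ))).mul hg.contDiffAt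
    · refine contDiffAt_const (c := (0 : ℂ)) |>.congr_of_eventuallyEq ?_
      filter_upwards [notMem_tsupport_iff_eventuallyEq.1 hξ] with η hη
      simp [hη]

/-- The field `v∇u - u∇v` is divergence free where `u` and `v` solve the same equation. -/
theorem flux_eq_zero {Ω : Set Pt} (hΩ : IsOpen Ω) {u v q : Pt → ℂ}
    (hu : ContDiffOn ℝ 1 u Ω) (hv : ContDiffOn ℝ 1 v Ω) (hq : Measurable q) {B : ℝ}
    (hB : ∀ ξ, ‖q ξ‖ ≤ B)
    (husol : ∀ φ : Pt → ℂ, ContDiff ℝ (⊤ : ℕ∞) φ → HasCompactSupport φ → tsupport φ ⊆ Ω →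
      ∫ ξ, u ξ * (lap φ ξ + q ξ * φ ξ) = 0)
    (hvsol : ∀ φ : Pt → ℂ, ContDiff ℝ (⊤ : ℕ∞) φ → HasCompactSupport φ → tsupport φ ⊆ Ω →
      ∫ ξ, v ξ * (lap φ ξ + q ξ * φ ξ) = 0)
    {ψ : Pt → ℂ} (hψ : ContDiff ℝ 1 ψ) (hψc : HasCompactSupport ψ) (hψΩ : tsupport ψ ⊆ Ω) :
    flux u v ψ = 0 := by
  have key : ∀ {w : Pt → ℂ}, ContDiffOn ℝ 1 w Ω → ContDiff ℝ 1 (fun ξ => w ξ * ψ ξ) ∧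
      HasCompactSupport (fun ξ => w ξ * ψ ξ) ∧ tsupport (fun ξ => w ξ * ψ ξ) ⊆ Ω := fun hw =>
    ⟨contDiff_mul_of_tsupport_subset hΩ hw hψ hψΩ, hψc.mul_left,
      tsupport_mul_subset_right.trans hψΩ⟩
  obtain ⟨hv1, hvc, hvΩ⟩ := key hv
  obtain ⟨hu1, huc, huΩ⟩ := key hu
  have e1 := integral_gradDot_eq_of_distributional hΩ hu hq hB husol hv1 hvc hvΩ
  have e2 := integral_gradDot_eq_of_distributional hΩ hv hq hB hvsol hu1 huc huΩ
  have e3 : ∫ ξ, gradDot u (fun ξ => v ξ * ψ ξ) ξ = ∫ ξ, gradDot v (fun ξ => u ξ * ψ ξ) ξ := by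
    rw [e1, e2]
    exact integral_congr_ae (ae_of_all _ fun ξ => by dsimp only; ring)
  rw [← sub_eq_zero, ← integral_sub (integrable_gradDot hΩ hu hv1 hvc hvΩ)
    (integrable_gradDot hΩ hv hu1 huc huΩ)] at e3
  rw [flux, ← e3]
  refine integral_congr_ae (ae_of_all _ fun ξ => ?_)
  dsimp only
  by_cases hξ : ξ ∈ tsupport ψ
  · have hdψ := hψ.differentiable one_ne_zero ξ
    rw [gradDot_mul (differentiableAt_of_contDiffOn hΩ hv (hψΩ hξ)) hdψ,
      gradDot_mul (differentiableAt_of_contDiffOn hΩ hu (hψΩ hξ)) hdψ, gradDot_comm v u]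
    ring
  · have h : ∀ w : Pt → ℂ, ξ ∉ tsupport (fun ξ => w ξ * ψ ξ) := fun w h =>
      hξ (tsupport_mul_subset_right h)
    simp only [gradDot_eq_zero_of_notMem_tsupport hξ, gradDot_eq_zero_of_notMem_tsupport (h _),
      mul_zero]

theorem integrable_mul_gradDot {Ω : Set Pt} (hΩ : IsOpen Ω) {v w g : Pt → ℂ}
    (hv : ContinuousOn v Ω) (hw : ContDiffOn ℝ 1 w Ω) (hg : ContDiff ℝ 1 g)
    (hgc : HasCompactSupport g) (hgΩ : ∀ e, tsupport (fun ξ => fderiv ℝ g ξ e) ⊆ Ω) :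
    Integrable (fun ξ => v ξ * gradDot w g ξ) := by
  have h : ∀ e, Integrable (fun ξ => (v ξ * fderiv ℝ w ξ e) * fderiv ℝ g ξ e) := fun e =>
    integrable_mul_of_tsupport_subset hΩ
      (hv.mul (continuousOn_fderiv_apply_of_contDiffOn hΩ hw e))
      (continuous_fderiv_apply_of_contDiff hg e) (hgc.fderiv_apply ℝ e) (hgΩ e)
  refine ((h (pt 1 0)).add (h (pt 0 1))).congr (ae_of_all _ fun ξ => ?_)
  simp only [gradDot, Pi.add_apply]
  ring

theorem integrable_flux {Ω : Set Pt} (hΩ : IsOpen Ω) {u v g : Pt → ℂ}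
    (hu : ContDiffOn ℝ 1 u Ω) (hv : ContDiffOn ℝ 1 v Ω) (hg : ContDiff ℝ 1 g)
    (hgc : HasCompactSupport g) (hgΩ : ∀ e, tsupport (fun ξ => fderiv ℝ g ξ e) ⊆ Ω) :
    Integrable (fun ξ => v ξ * gradDot u g ξ - u ξ * gradDot v g ξ) :=
  (integrable_mul_gradDot hΩ hv.continuousOn hu hg hgc hgΩ).sub
    (integrable_mul_gradDot hΩ hu.continuousOn hv hg hgc hgΩ)

/-- The flux through a small loop, expressed without derivatives of `u`. -/
theorem flux_eq_integral_lap {Ω : Set Pt} (hΩ : IsOpen Ω) {u v g : Pt → ℂ}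
    (hu : ContDiffOn ℝ 1 u Ω) (hv : ContDiffOn ℝ 1 v Ω) (hg : ContDiff ℝ 2 g)
    (hgc : HasCompactSupport g) (hgΩ : ∀ e, tsupport (fun ξ => fderiv ℝ g ξ e) ⊆ Ω) :
    flux u v g = -(∫ ξ, u ξ * v ξ * lap g ξ) - 2 * ∫ ξ, u ξ * gradDot v g ξ := by
  have hg1 : ContDiff ℝ 1 g := hg.of_le one_le_two
  have h1 := integrable_mul_gradDot hΩ hv.continuousOn hu hg1 hgc hgΩ
  have h2 := integrable_mul_gradDot hΩ hu.continuousOn hv hg1 hgc hgΩ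
  rw [integral_mul_lap hΩ (hu.mul hv) hg hgc hgΩ, neg_neg, flux, integral_sub h1 h2]
  have h3 : ∫ ξ, gradDot (u * v) g ξ = ∫ ξ, (u ξ * gradDot v g ξ + v ξ * gradDot u g ξ) := by
    refine integral_congr_ae (ae_of_all _ fun ξ => ?_)
    dsimp only
    by_cases hξ : ξ ∈ Ω
    · rw [gradDot_comm, gradDot_comm v, gradDot_comm u]
      exact gradDot_mul (differentiableAt_of_contDiffOn hΩ hu hξ)
        (differentiableAt_of_contDiffOn hΩ hv hξ)
    · have h : ∀ e, fderiv ℝ g ξ e = 0 := fun e =>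
        image_eq_zero_of_notMem_tsupport (f := fun ξ => fderiv ℝ g ξ e) fun h => hξ (hgΩ e h)
      simp [gradDot, h]
  rw [show (∫ ξ, gradDot (fun ξ => u ξ * v ξ) g ξ) = ∫ ξ, gradDot (u * v) g ξ from rfl, h3,
    integral_add h2 h1]
  ring

/-- A smooth radial cutoff, equal to `1` on the unit ball and to `0` outside the ball of
radius `2`. -/
def cutoff (ζ : Pt) : ℂ := (Real.smoothTransition (2 - ‖ζ‖ ^ 2) : ℂ)

theorem contDiff_cutoff : ContDiff ℝ (⊤ : ℕ∞) cutoff :=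
  Complex.ofRealCLM.contDiff.comp
    (Real.smoothTransition.contDiff.comp (contDiff_const.sub (contDiff_norm_sq ℝ)))

theorem cutoff_eq_one {ζ : Pt} (h : ‖ζ‖ ≤ 1) : cutoff ζ = 1 := by
  rw [cutoff, Real.smoothTransition.one_of_one_le, Complex.ofReal_one]
  nlinarith [norm_nonneg ζ]

theorem cutoff_eq_zero {ζ : Pt} (h : 2 ≤ ‖ζ‖) : cutoff ζ = 0 := by
  rw [cutoff, Real.smoothTransition.zero_of_nonpos, Complex.ofReal_zero]
  nlinarith

theorem hasCompactSupport_cutoff : HasCompactSupport cutoff :=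
  HasCompactSupport.intro (isCompact_closedBall (0 : Pt) 2) fun ζ hζ => by
    rw [mem_closedBall_zero_iff, not_le] at hζ
    exact cutoff_eq_zero hζ.le

theorem norm_cutoff_le (ζ : Pt) : ‖cutoff ζ‖ ≤ 1 := by
  rw [cutoff, Complex.norm_real, Real.norm_of_nonneg (Real.smoothTransition.nonneg _)]
  exact Real.smoothTransition.le_one _

/-- The gradient of the cutoff is radial. -/
theorem exists_fderiv_cutoff_eq :
    ∃ (k : Pt → ℂ) (N : ℝ), (∀ ζ e, fderiv ℝ cutoff ζ e = k ζ * (inner ℝ ζ e : ℝ)) ∧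
      ∀ ζ, ‖ζ‖ ≤ 2 → ‖k ζ‖ ≤ N := by
  let k : Pt → ℝ := fun ζ => -2 * deriv Real.smoothTransition (2 - ‖ζ‖ ^ 2)
  have hk : Continuous k := by
    have := (Real.smoothTransition.contDiff (n := 1)).continuous_deriv le_rfl
    fun_prop
  obtain ⟨N, hN⟩ := (isCompact_closedBall (0 : Pt) 2).exists_bound_of_continuousOn hk.continuousOn
  refine ⟨fun ζ => (k ζ : ℂ), N, fun ζ e => ?_, fun ζ hζ => ?_⟩
  · have h1 : HasFDerivAt (fun ζ : Pt => 2 - ‖ζ‖ ^ 2) (-(2 • innerSL ℝ ζ)) ζ :=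
      (hasStrictFDerivAt_norm_sq ζ).hasFDerivAt.const_sub 2
    have h2 : HasDerivAt Real.smoothTransition (deriv Real.smoothTransition (2 - ‖ζ‖ ^ 2))
        (2 - ‖ζ‖ ^ 2) :=
      ((Real.smoothTransition.contDiff (n := 1)).differentiable one_ne_zero _).hasDerivAt
    have h3 := Complex.ofRealCLM.hasFDerivAt.comp ζ (h2.comp_hasFDerivAt ζ h1)
    have h4 : fderiv ℝ cutoff ζ = _ := h3.fderiv
    rw [h4]
    simp [k]
    ring
  · rw [Complex.norm_real]
    exact hN ζ (by simpa using hζ)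

/-- The cutoff rescaled to the ball of radius `c⁻¹` around `a`. -/
def scaledCutoff (c : ℝ) (a ξ : Pt) : ℂ := cutoff (c • (ξ - a))

theorem fderiv_comp_smul_sub (F : Pt → ℂ) (c : ℝ) (a ξ e : Pt) :
    fderiv ℝ (fun ξ => F (c • (ξ - a))) ξ e = c * fderiv ℝ F (c • (ξ - a)) e := by
  have h1 := fderiv_comp_sub (𝕜 := ℝ) (f := fun y => F (c • y)) (x := ξ) a
  have h2 := fderiv_comp_smul (𝕜 := ℝ) (f := F) (x := ξ - a) c
  rw [h1]
  rw [h2]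
  simp

theorem fderiv_scaledCutoff (c : ℝ) (a ξ e : Pt) :
    fderiv ℝ (scaledCutoff c a) ξ e = c * fderiv ℝ cutoff (c • (ξ - a)) e :=
  fderiv_comp_smul_sub cutoff c a ξ e

theorem lap_scaledCutoff (c : ℝ) (a ξ : Pt) :
    lap (scaledCutoff c a) ξ = c ^ 2 * lap cutoff (c • (ξ - a)) := by
  have h : ∀ e, fderiv ℝ (fun y => fderiv ℝ (scaledCutoff c a) y e) ξ e
      = c ^ 2 * fderiv ℝ (fun y => fderiv ℝ cutoff y e) (c • (ξ - a)) e := fun e => by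
    have h1 : (fun y => fderiv ℝ (scaledCutoff c a) y e)
        = c • fun y => fderiv ℝ cutoff (c • (y - a)) e :=
      funext fun y => by simp [fderiv_scaledCutoff]
    have h2 := fderiv_comp_smul_sub (fun y => fderiv ℝ cutoff y e) c a ξ e
    rw [h1, fderiv_const_smul_field, Pi.smul_apply, smul_apply, h2, Complex.real_smul]
    ring
  simp only [lap, h, mul_add]

theorem contDiff_scaledCutoff (c : ℝ) (a : Pt) : ContDiff ℝ (⊤ : ℕ∞) (scaledCutoff c a) :=
  contDiff_cutoff.comp (by fun_prop : ContDiff ℝ (⊤ : ℕ∞) fun ξ : Pt => c • (ξ - a))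

theorem scaledCutoff_eq_one {c : ℝ} (hc : 0 < c) {a ξ : Pt} (h : c * ‖ξ - a‖ ≤ 1) :
    scaledCutoff c a ξ = 1 :=
  cutoff_eq_one (by rwa [norm_smul, Real.norm_of_nonneg hc.le])

theorem scaledCutoff_eq_zero {c : ℝ} (hc : 0 < c) {a ξ : Pt} (h : 2 ≤ c * ‖ξ - a‖) :
    scaledCutoff c a ξ = 0 :=
  cutoff_eq_zero (by rwa [norm_smul, Real.norm_of_nonneg hc.le])

theorem scaledCutoff_eq_zero_of_notMem {c : ℝ} (hc : 0 < c) {a ξ : Pt}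
    (h : ξ ∉ Metric.closedBall a (2 / c)) : scaledCutoff c a ξ = 0 := by
  rw [mem_closedBall_iff_norm, not_le, div_lt_iff₀ hc] at h
  exact scaledCutoff_eq_zero hc (by linarith)

theorem tsupport_scaledCutoff_subset {c : ℝ} (hc : 0 < c) (a : Pt) :
    tsupport (scaledCutoff c a) ⊆ Metric.closedBall a (2 / c) :=
  closure_minimal (fun ξ hξ => by
    by_contra h
    exact hξ (scaledCutoff_eq_zero_of_notMem hc h)) Metric.isClosed_closedBall

theorem hasCompactSupport_scaledCutoff {c : ℝ} (hc : 0 < c) (a : Pt) :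
    HasCompactSupport (scaledCutoff c a) :=
  (isCompact_closedBall a (2 / c)).of_isClosed_subset (isClosed_tsupport _)
    (tsupport_scaledCutoff_subset hc a)

theorem scaledCutoff_eventuallyEq_one {c : ℝ} (hc : 0 < c) {a ξ : Pt} (h : c * ‖ξ - a‖ < 1) :
    scaledCutoff c a =ᶠ[𝓝 ξ] 1 := by
  have ho : IsOpen {ξ : Pt | c * ‖ξ - a‖ < 1} := isOpen_lt (by fun_prop) (by fun_prop)
  filter_upwards [ho.mem_nhds h] with ζ hζ
  exact scaledCutoff_eq_one hc (le_of_lt hζ)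

theorem scaledCutoff_eventuallyEq_zero {c : ℝ} (hc : 0 < c) {a ξ : Pt} (h : 2 < c * ‖ξ - a‖) :
    scaledCutoff c a =ᶠ[𝓝 ξ] 0 := by
  have ho : IsOpen {ξ : Pt | 2 < c * ‖ξ - a‖} := isOpen_lt (by fun_prop) (by fun_prop)
  filter_upwards [ho.mem_nhds h] with ζ hζ
  exact scaledCutoff_eq_zero hc (le_of_lt hζ)

theorem tsupport_fderiv_scaledCutoff_subset {c : ℝ} (hc : 0 < c) (a e : Pt) :
    tsupport (fun ξ => fderiv ℝ (scaledCutoff c a) ξ e) ⊆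
      {ξ | 1 ≤ c * ‖ξ - a‖ ∧ c * ‖ξ - a‖ ≤ 2} := by
  intro ξ hξ
  refine ⟨?_, ?_⟩
  · have hcl : IsClosed {ξ : Pt | 1 ≤ c * ‖ξ - a‖} := isClosed_le (by fun_prop) (by fun_prop)
    refine closure_minimal (fun η hη => ?_) hcl hξ
    by_contra h
    have hev := scaledCutoff_eventuallyEq_one hc (not_le.1 h)
    refine hη ?_
    dsimp only
    rw [hev.fderiv_eq]
    simp
  · have := tsupport_scaledCutoff_subset hc a (tsupport_fderiv_apply_subset ℝ e hξ)
    rw [mem_closedBall_iff_norm, le_div_iff₀ hc] at this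
    linarith

theorem exists_bound_cutoff :
    ∃ M > 0, (∀ ζ, ‖fderiv ℝ cutoff ζ‖ ≤ M) ∧ ∀ ζ, ‖lap cutoff ζ‖ ≤ M := by
  have h2 : ContDiff ℝ 2 cutoff := contDiff_infty.1 contDiff_cutoff 2
  obtain ⟨M₁, h₁⟩ := (hasCompactSupport_cutoff.fderiv ℝ).exists_bound_of_continuous
    (h2.continuous_fderiv two_ne_zero)
  have h3 : HasCompactSupport (lap cutoff) :=
    hasCompactSupport_cutoff.of_isClosed_subset (isClosed_tsupport _) (tsupport_lap_subset _)
  obtain ⟨M₂, h₂⟩ := h3.exists_bound_of_continuous (continuous_lap h2)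
  refine ⟨max 1 (max M₁ M₂), by positivity, fun ζ => (h₁ ζ).trans ?_, fun ζ => (h₂ ζ).trans ?_⟩ <;>
  simp

theorem norm_pt_one_zero : ‖pt 1 0‖ = 1 := by
  simp [pt, EuclideanSpace.norm_eq]

theorem norm_pt_zero_one : ‖pt 0 1‖ = 1 := by
  simp [pt, EuclideanSpace.norm_eq]

theorem norm_gradDot_le (f g : Pt → ℂ) (ξ : Pt) :
    ‖gradDot f g ξ‖ ≤ 2 * (‖fderiv ℝ f ξ‖ * ‖fderiv ℝ g ξ‖) := by
  have h : ∀ e : Pt, ‖e‖ = 1 → ‖fderiv ℝ f ξ e * fderiv ℝ g ξ e‖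
      ≤ ‖fderiv ℝ f ξ‖ * ‖fderiv ℝ g ξ‖ := fun e he => by
    rw [norm_mul]
    have h1 := (fderiv ℝ f ξ).le_opNorm e
    have h2 := (fderiv ℝ g ξ).le_opNorm e
    rw [he, mul_one] at h1 h2
    exact mul_le_mul h1 h2 (norm_nonneg _) (norm_nonneg _)
  have := norm_add_le_of_le (h _ norm_pt_one_zero) (h _ norm_pt_zero_one)
  rw [gradDot]
  linarith

theorem norm_fderiv_scaledCutoff_le {M : ℝ} (hM : ∀ ζ, ‖fderiv ℝ cutoff ζ‖ ≤ M) {c : ℝ}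
    (hc : 0 < c) (a ξ : Pt) : ‖fderiv ℝ (scaledCutoff c a) ξ‖ ≤ c * M := by
  refine ContinuousLinearMap.opNorm_le_bound _
    (mul_nonneg hc.le ((norm_nonneg _).trans (hM 0))) fun e => ?_
  rw [fderiv_scaledCutoff, norm_mul, Complex.norm_real, Real.norm_of_nonneg hc.le, mul_assoc]
  refine mul_le_mul_of_nonneg_left ((ContinuousLinearMap.le_opNorm _ _).trans ?_) hc.le
  exact mul_le_mul_of_nonneg_right (hM _) (norm_nonneg _)

theorem norm_lap_scaledCutoff_le {M : ℝ} (hM : ∀ ζ, ‖lap cutoff ζ‖ ≤ M) (c : ℝ) (a ξ : Pt) :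
    ‖lap (scaledCutoff c a) ξ‖ ≤ c ^ 2 * M := by
  rw [lap_scaledCutoff, norm_mul, norm_pow, Complex.norm_real, Real.norm_eq_abs, sq_abs]
  exact mul_le_mul_of_nonneg_left (hM _) (sq_nonneg c)

/-- Integrals of functions of size `o(c²)` supported in balls of radius `2 / c` tend to zero. -/
theorem tendsto_integral_zero_of_support {F : ℕ → Pt → ℂ} {c : ℕ → ℝ} {a : Pt}
    (hc : ∀ᶠ n in atTop, 0 < c n)
    (hsupp : ∀ᶠ n in atTop, ∀ ξ ∉ Metric.closedBall a (2 / c n), F n ξ = 0)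
    (hF : ∀ δ > 0, ∀ᶠ n in atTop, ∀ ξ ∈ Metric.closedBall a (2 / c n), ‖F n ξ‖ ≤ δ * c n ^ 2) :
    Tendsto (fun n => ∫ ξ, F n ξ) atTop (𝓝 0) := by
  set A : ℝ := volume.real (Metric.ball (0 : Pt) 1) with hA
  have hA0 : 0 ≤ A := measureReal_nonneg
  rw [tendsto_zero_iff_norm_tendsto_zero, tendsto_order]
  refine ⟨fun b hb => Eventually.of_forall fun n => hb.trans_le (norm_nonneg _), fun b hb => ?_⟩
  filter_upwards [hc, hsupp, hF (b / (4 * A + 1)) (by positivity)] with n hcn hs hn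
  have hvol : volume.real (Metric.closedBall a (2 / c n)) = (2 / c n) ^ 2 * A := by
    rw [hA, Measure.real, Measure.addHaar_closedBall _ _ (by positivity),
      finrank_euclideanSpace_fin, ENNReal.toReal_mul, ENNReal.toReal_ofReal (by positivity),
      Measure.real]
  rw [← setIntegral_eq_integral_of_forall_compl_eq_zero hs]
  refine (norm_setIntegral_le_of_norm_le_const measure_closedBall_lt_top hn).trans_lt ?_
  rw [hvol]
  have : b / (4 * A + 1) * c n ^ 2 * ((2 / c n) ^ 2 * A) = b * (4 * A / (4 * A + 1)) := by
    field_simp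
    ring
  rw [this]
  have h1 : 4 * A / (4 * A + 1) < 1 := by
    rw [div_lt_one (by positivity)]
    linarith
  nlinarith

theorem eventually_closedBall_two_div_subset {x : Pt} {s : Set Pt} (hs : s ∈ 𝓝 x) :
    ∀ᶠ n : ℕ in atTop, Metric.closedBall x (2 / (n : ℝ)) ⊆ s := by
  obtain ⟨ε, hε, h⟩ := Metric.nhds_basis_closedBall.mem_iff.1 hs
  have : Tendsto (fun n : ℕ => 2 / (n : ℝ)) atTop (𝓝 0) :=
    tendsto_natCast_atTop_atTop.const_div_atTop 2
  filter_upwards [this.eventually (ge_mem_nhds hε)] with n hn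
  exact (Metric.closedBall_subset_closedBall hn).trans h

theorem exists_lipschitz_bound {v : Pt → ℂ} {V : Set Pt} (hV : IsOpen V) {x : Pt} (hx : x ∈ V)
    (hv : ContDiffOn ℝ 1 v V) :
    ∃ L > 0, ∀ᶠ ξ in 𝓝 x, ‖v ξ - v x‖ ≤ L * ‖ξ - x‖ ∧ ‖fderiv ℝ v ξ‖ ≤ L := by
  obtain ⟨K, t, ht, hK⟩ :=
    ((hv.contDiffAt (hV.mem_nhds hx)).restrict_scalars ℝ).exists_lipschitzOnWith
  refine ⟨K + 1, by positivity, ?_⟩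
  filter_upwards [ht, eventually_mem_nhds_iff.2 ht] with ξ h1 h2
  constructor
  · have := hK.norm_sub_le h1 (mem_of_mem_nhds ht)
    nlinarith [norm_nonneg (ξ - x)]
  · exact (norm_fderiv_le_of_lipschitzOn ℝ h2 hK).trans (by simp)

/-- The flux of a point source through a shrinking loop recovers point evaluation. -/
theorem tendsto_flux_scaledCutoff {u v q : Pt → ℂ} {x : Pt} (hloc : LocallyIntegrable u)
    (hq : Measurable q) {B : ℝ} (hB : ∀ ξ, ‖q ξ‖ ≤ B)
    (hsol : ∀ φ : Pt → ℂ, ContDiff ℝ (⊤ : ℕ∞) φ → HasCompactSupport φ →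
      ∫ ξ, u ξ * (lap φ ξ + q ξ * φ ξ) = -φ x)
    (hu : ContDiffOn ℝ 1 u {x}ᶜ)
    (hsing : Tendsto (fun ξ => ‖ξ - x‖ * ‖u ξ‖) (𝓝[≠] x) (𝓝 0))
    {V : Set Pt} (hV : IsOpen V) (hxV : x ∈ V) (hv : ContDiffOn ℝ 1 v V) :
    Tendsto (fun n : ℕ => flux u v (scaledCutoff n x)) atTop (𝓝 (v x)) := by
  obtain ⟨L, hL, hvL⟩ := exists_lipschitz_bound hV hxV hv
  obtain ⟨M, hM, hM1, hM2⟩ := exists_bound_cutoff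
  have hpos : ∀ᶠ n : ℕ in atTop, 0 < (n : ℝ) :=
    (eventually_gt_atTop 0).mono fun n hn => Nat.cast_pos.2 hn
  have hsmall : ∀ δ > 0, ∀ᶠ n : ℕ in atTop, ∀ ξ, 1 ≤ (n : ℝ) * ‖ξ - x‖ → (n : ℝ) * ‖ξ - x‖ ≤ 2 →
      ‖u ξ‖ ≤ δ * n ∧ ‖v ξ - v x‖ ≤ L * (2 / n) ∧ ‖fderiv ℝ v ξ‖ ≤ L := by
    intro δ hδ
    have h1 := eventually_nhdsWithin_iff.1 (hsing.eventually (ge_mem_nhds hδ))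
    filter_upwards [eventually_closedBall_two_div_subset (h1.and hvL), hpos] with n hn hn0 ξ hξ1 hξ2
    have hr : ‖ξ - x‖ ≤ 2 / n := by rwa [le_div_iff₀ hn0, mul_comm]
    have hξ := hn (mem_closedBall_iff_norm.2 hr)
    have hne : ξ ∈ ({x}ᶜ : Set Pt) := fun h => by
      rw [Set.mem_singleton_iff.1 h, sub_self, norm_zero, mul_zero] at hξ1
      linarith
    refine ⟨?_, hξ.2.1.trans (mul_le_mul_of_nonneg_left hr hL.le), hξ.2.2⟩
    calc ‖u ξ‖ ≤ (n * ‖ξ - x‖) * ‖u ξ‖ := le_mul_of_one_le_left (norm_nonneg _) hξ1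
      _ = n * (‖ξ - x‖ * ‖u ξ‖) := by ring
      _ ≤ n * δ := mul_le_mul_of_nonneg_left (hξ.1 hne) hn0.le
      _ = δ * n := mul_comm _ _
  have houter : ∀ {n : ℕ} {ξ : Pt}, 0 < (n : ℝ) → ξ ∉ Metric.closedBall x (2 / (n : ℝ)) →
      ξ ∉ tsupport (scaledCutoff n x) := fun hn hξ h => hξ (tsupport_scaledCutoff_subset hn x h)
  have hannulus : ∀ {n : ℕ}, 0 < (n : ℝ) → ∀ {ξ : Pt},
      ¬ (1 ≤ (n : ℝ) * ‖ξ - x‖ ∧ (n : ℝ) * ‖ξ - x‖ ≤ 2) →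
        (∀ w, gradDot w (scaledCutoff n x) ξ = 0) ∧ lap (scaledCutoff n x) ξ = 0 := by
    intro n hn ξ hξ
    have h0 : ∀ e, ξ ∉ tsupport (fun ξ => fderiv ℝ (scaledCutoff n x) ξ e) := fun e h =>
      hξ (tsupport_fderiv_scaledCutoff_subset hn x e h)
    have h1 : ∀ e, fderiv ℝ (scaledCutoff n x) ξ e = 0 := fun e =>
      image_eq_zero_of_notMem_tsupport (f := fun ξ => fderiv ℝ (scaledCutoff n x) ξ e) (h0 e)
    have h2 : ∀ e, fderiv ℝ (fun ξ => fderiv ℝ (scaledCutoff n x) ξ e) ξ = 0 := fun e =>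
      image_eq_zero_of_notMem_tsupport fun h => h0 e (tsupport_fderiv_subset ℝ h)
    exact ⟨fun w => by simp [gradDot, h1], by simp [lap, h2]⟩
  have hT1 : Tendsto (fun n : ℕ => ∫ ξ, u ξ * (v ξ - v x) * lap (scaledCutoff n x) ξ)
      atTop (𝓝 0) := by
    refine tendsto_integral_zero_of_support (c := fun n => (n : ℝ)) (a := x) hpos ?_ ?_
    · filter_upwards [hpos] with n hn ξ hξ
      rw [image_eq_zero_of_notMem_tsupport fun h =>
        houter hn hξ (tsupport_lap_subset _ h), mul_zero]
    · intro δ hδ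
      filter_upwards [hpos, hsmall (δ / (2 * L * M)) (by positivity)] with n hn hb ξ _
      by_cases hξ : 1 ≤ (n : ℝ) * ‖ξ - x‖ ∧ (n : ℝ) * ‖ξ - x‖ ≤ 2
      · obtain ⟨h1, h2, -⟩ := hb ξ hξ.1 hξ.2
        rw [norm_mul, norm_mul]
        calc ‖u ξ‖ * ‖v ξ - v x‖ * ‖lap (scaledCutoff n x) ξ‖
            ≤ (δ / (2 * L * M) * n) * (L * (2 / n)) * (n ^ 2 * M) := by
              gcongr
              exact norm_lap_scaledCutoff_le hM2 _ _ _
          _ = δ * n ^ 2 := by field_simp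
      · rw [(hannulus hn hξ).2, mul_zero, norm_zero]
        positivity
  have hT3 : Tendsto (fun n : ℕ => ∫ ξ, u ξ * gradDot v (scaledCutoff n x) ξ) atTop (𝓝 0) := by
    refine tendsto_integral_zero_of_support (c := fun n => (n : ℝ)) (a := x) hpos ?_ ?_
    · filter_upwards [hpos] with n hn ξ hξ
      rw [gradDot_eq_zero_of_notMem_tsupport (houter hn hξ), mul_zero]
    · intro δ hδ
      filter_upwards [hpos, hsmall (δ / (2 * L * M)) (by positivity)] with n hn hb ξ _
      by_cases hξ : 1 ≤ (n : ℝ) * ‖ξ - x‖ ∧ (n : ℝ) * ‖ξ - x‖ ≤ 2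
      · obtain ⟨h1, -, h3⟩ := hb ξ hξ.1 hξ.2
        rw [norm_mul]
        calc ‖u ξ‖ * ‖gradDot v (scaledCutoff n x) ξ‖
            ≤ (δ / (2 * L * M) * n) * (2 * (L * (n * M))) := by
              gcongr
              refine (norm_gradDot_le _ _ _).trans ?_
              gcongr
              exact norm_fderiv_scaledCutoff_le hM1 hn _ _
          _ = δ * n ^ 2 := by field_simp
      · rw [(hannulus hn hξ).1, mul_zero, norm_zero]
        positivity
  have hT2 : Tendsto (fun n : ℕ => ∫ ξ, q ξ * (u ξ * scaledCutoff n x ξ)) atTop (𝓝 0) := by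
    rw [← integral_zero Pt ℂ (μ := volume)]
    refine tendsto_integral_filter_of_dominated_convergence
      ((Metric.closedBall x 2).indicator fun ξ => B * ‖u ξ‖) ?_ ?_ ?_ ?_
    · exact Eventually.of_forall fun n => hq.aestronglyMeasurable.mul
        (hloc.aestronglyMeasurable.mul (contDiff_scaledCutoff _ _).continuous.aestronglyMeasurable)
    · filter_upwards [eventually_ge_atTop 1] with n hn
      have hn1 : (1 : ℝ) ≤ n := Nat.one_le_cast.2 hn
      refine ae_of_all _ fun ξ => ?_
      by_cases hξ : ξ ∈ Metric.closedBall x 2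
      · rw [Set.indicator_of_mem hξ, norm_mul, norm_mul]
        have := norm_cutoff_le ((n : ℝ) • (ξ - x))
        exact mul_le_mul (hB ξ) (mul_le_of_le_one_right (norm_nonneg _) this) (by positivity)
          ((norm_nonneg _).trans (hB ξ))
      · have : ξ ∉ Metric.closedBall x (2 / (n : ℝ)) := fun h =>
          hξ (Metric.closedBall_subset_closedBall (div_le_self zero_le_two hn1) h)
        rw [Set.indicator_of_notMem hξ, scaledCutoff_eq_zero_of_notMem (by linarith) this]
        simp
    · rw [integrable_indicator_iff Metric.isClosed_closedBall.measurableSet]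
      exact (hloc.integrableOn_isCompact (isCompact_closedBall x 2)).norm.const_mul B
    · have hne : ∀ᵐ ξ : Pt, ξ ≠ x := Measure.ae_ne volume x
      filter_upwards [hne] with ξ hξ
      refine tendsto_const_nhds.congr' ?_
      have hξ' : 0 < ‖ξ - x‖ := norm_pos_iff.2 (sub_ne_zero.2 hξ)
      filter_upwards [hpos, tendsto_natCast_atTop_atTop.eventually_ge_atTop (2 / ‖ξ - x‖)]
        with n hn hn2
      rw [scaledCutoff_eq_zero hn ((div_le_iff₀ hξ').1 hn2)]
      simp
  have hlim := (hT1.neg.add (hT2.const_mul (v x))).sub (hT3.const_mul 2)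
  have hlim' := hlim.add_const (v x)
  simp only [neg_zero, mul_zero, add_zero, sub_zero, zero_add] at hlim'
  refine hlim'.congr' ?_
  filter_upwards [hpos, eventually_closedBall_two_div_subset (hV.mem_nhds hxV)] with n hn hnV
  set η := scaledCutoff n x with hη
  have hη2 : ContDiff ℝ 2 η := contDiff_infty.1 (contDiff_scaledCutoff _ _) 2
  have hηc : HasCompactSupport η := hasCompactSupport_scaledCutoff hn x
  have hηΩ : ∀ e, tsupport (fun ξ => fderiv ℝ η ξ e) ⊆ V ∩ {x}ᶜ := fun e ξ hξ => by
    obtain ⟨h1, -⟩ := tsupport_fderiv_scaledCutoff_subset hn x e hξ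
    refine ⟨hnV (tsupport_scaledCutoff_subset hn x (tsupport_fderiv_apply_subset ℝ e hξ)),
      fun h => ?_⟩
    rw [Set.mem_singleton_iff.1 h, sub_self, norm_zero, mul_zero] at h1
    linarith
  have hΩ : IsOpen (V ∩ {x}ᶜ) := hV.inter isOpen_compl_singleton
  have huΩ := hu.mono (Set.inter_subset_right (s := V))
  have hvΩ := hv.mono (Set.inter_subset_left (t := {x}ᶜ))
  have hlapΩ : tsupport (lap η) ⊆ V ∩ {x}ᶜ :=
    (tsupport_add _ _).trans (Set.union_subset
      ((tsupport_fderiv_apply_subset ℝ _).trans (hηΩ _))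
      ((tsupport_fderiv_apply_subset ℝ _).trans (hηΩ _)))
  have hlapc : HasCompactSupport (lap η) :=
    hηc.of_isClosed_subset (isClosed_tsupport _) (tsupport_lap_subset _)
  have hi1 : Integrable (fun ξ => u ξ * lap η ξ) :=
    integrable_mul_of_tsupport_subset hΩ huΩ.continuousOn (continuous_lap hη2) hlapc hlapΩ
  have hi2 : Integrable (fun ξ => (u ξ * v ξ) * lap η ξ) :=
    integrable_mul_of_tsupport_subset hΩ (huΩ.continuousOn.mul hvΩ.continuousOn)
      (continuous_lap hη2) hlapc hlapΩ
  have hi3 : Integrable (fun ξ => q ξ * (u ξ * η ξ)) := by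
    refine Integrable.bdd_mul (c := B) ?_ hq.aestronglyMeasurable (ae_of_all _ hB)
    have := hloc.integrable_smul_right_of_hasCompactSupport hη2.continuous hηc
    simpa [mul_comm] using this
  have hs := hsol η (contDiff_scaledCutoff _ _) hηc
  have hηx : η x = 1 := scaledCutoff_eq_one hn (by simp)
  have hsplit : ∀ ξ, u ξ * (lap η ξ + q ξ * η ξ) = u ξ * lap η ξ + q ξ * (u ξ * η ξ) :=
    fun ξ => by ring
  simp only [hsplit] at hs
  rw [integral_add hi1 hi3, hηx] at hs
  have hdiff : ∫ ξ, u ξ * (v ξ - v x) * lap η ξ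
      = (∫ ξ, (u ξ * v ξ) * lap η ξ) - v x * ∫ ξ, u ξ * lap η ξ := by
    rw [← integral_const_mul, ← integral_sub hi2 (hi1.const_mul _)]
    exact integral_congr_ae (ae_of_all _ fun ξ => by dsimp only; ring)
  rw [flux_eq_integral_lap hΩ huΩ hvΩ hη2 hηc hηΩ, hdiff]
  linear_combination v x * hs

theorem fderiv_apply_self (w : Pt → ℂ) (ξ : Pt) :
    fderiv ℝ w ξ (pt 1 0) * (ξ 0 : ℂ) + fderiv ℝ w ξ (pt 0 1) * (ξ 1 : ℂ) = ‖ξ‖ * dnu w ξ := by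
  have h : ξ = ξ 0 • pt 1 0 + ξ 1 • pt 0 1 := by
    ext i
    fin_cases i <;> simp [pt]
  have h1 : fderiv ℝ w ξ ξ = ξ 0 * fderiv ℝ w ξ (pt 1 0) + ξ 1 * fderiv ℝ w ξ (pt 0 1) := by
    conv_lhs => rw [show fderiv ℝ w ξ ξ = fderiv ℝ w ξ (ξ 0 • pt 1 0 + ξ 1 • pt 0 1) from
      congrArg _ h]
    simp
  have h2 : (‖ξ‖ : ℂ) * dnu w ξ = fderiv ℝ w ξ ξ := by
    rcases eq_or_ne ξ 0 with rfl | hξ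
    · simp
    · have : (‖ξ‖ : ℂ) ≠ 0 := by simpa using hξ
      rw [dnu, map_smul, Complex.real_smul, Complex.ofReal_inv, mul_inv_cancel_left₀ this]
  rw [h2, h1]
  ring

/-- The flux of two radiating fields through large circles tends to zero. -/
theorem tendsto_flux_scaledCutoff_of_radiationDecay {κ1 κ2 : ℝ} {u v : Pt → ℂ}
    (hu : RadiationDecay κ1 κ2 u) (hv : RadiationDecay κ1 κ2 v) :
    Tendsto (fun n : ℕ => flux u v (scaledCutoff (n : ℝ)⁻¹ 0)) atTop (𝓝 0) := by
  obtain ⟨C, hC, ρ, hρ, hu⟩ := hu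
  obtain ⟨C', hC', ρ', hρ', hv⟩ := hv
  obtain ⟨k, N, hk, hN⟩ := exists_fderiv_cutoff_eq
  have hN0 : 0 ≤ N := (norm_nonneg _).trans (hN 0 (by simp))
  have hpos : ∀ᶠ n : ℕ in atTop, 0 < (n : ℝ)⁻¹ :=
    (eventually_gt_atTop 0).mono fun n hn => inv_pos.2 (Nat.cast_pos.2 hn)
  have hgrad : ∀ (w : Pt → ℂ) (c : ℝ) (ξ : Pt), gradDot w (scaledCutoff c 0) ξ
      = c ^ 2 * k (c • ξ) * (‖ξ‖ * dnu w ξ) := by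
    intro w c ξ
    rw [← fderiv_apply_self, gradDot, fderiv_scaledCutoff, fderiv_scaledCutoff, hk, hk, sub_zero]
    have h0 : inner ℝ (c • ξ) (pt 1 0) = c * ξ 0 := by
      simp [pt, PiLp.inner_apply]
    have h1 : inner ℝ (c • ξ) (pt 0 1) = c * ξ 1 := by
      simp [pt, PiLp.inner_apply]
    rw [h0, h1]
    push_cast
    ring
  refine tendsto_integral_zero_of_support (c := fun n : ℕ => (n : ℝ)⁻¹) (a := 0) hpos ?_ ?_
  · filter_upwards [hpos] with n hn ξ hξ
    have h : ξ ∉ tsupport (scaledCutoff (n : ℝ)⁻¹ 0) := fun h =>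
      hξ (tsupport_scaledCutoff_subset hn 0 h)
    simp only [gradDot_eq_zero_of_notMem_tsupport h, mul_zero, sub_zero]
  · intro δ hδ
    have h1 : ∀ᶠ n : ℕ in atTop, 4 * N * (C * C') * (n : ℝ)⁻¹ ≤ δ := by
      have : Tendsto (fun n : ℕ => 4 * N * (C * C') * (n : ℝ)⁻¹) atTop (𝓝 0) := by
        simpa using (tendsto_natCast_atTop_atTop (R := ℝ)).inv_tendsto_atTop.const_mul
          (4 * N * (C * C'))
      exact this.eventually (ge_mem_nhds hδ)
    filter_upwards [hpos, h1, tendsto_natCast_atTop_atTop.eventually_ge_atTop (max ρ ρ')]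
      with n hn hδn hρn ξ hξ
    set c := (n : ℝ)⁻¹ with hc
    rw [mem_closedBall_zero_iff, le_div_iff₀ hn] at hξ
    rw [hgrad, hgrad]
    by_cases hin : 1 ≤ c * ‖ξ‖
    · have hnξ : (n : ℝ) ≤ ‖ξ‖ := by
        have := inv_pos.1 hn
        rwa [hc, inv_mul_eq_div, one_le_div this] at hin
      have hξ0 : 0 < ‖ξ‖ := (inv_pos.1 hn).trans_le hnξ
      obtain ⟨hu1, hu2⟩ := hu ξ (((le_max_left _ _).trans hρn).trans hnξ)
      obtain ⟨hv1, hv2⟩ := hv ξ (((le_max_right _ _).trans hρn).trans hnξ)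
      have hrp : ‖ξ‖ ^ (-(1 / 2) : ℝ) * ‖ξ‖ ^ (-(3 / 2) : ℝ) ≤ c ^ 2 := by
        rw [← Real.rpow_add hξ0, show (-(1 / 2) + -(3 / 2) : ℝ) = -(2 : ℕ) by norm_num,
          Real.rpow_neg hξ0.le, Real.rpow_natCast]
        refine inv_le_of_inv_le₀ (by positivity) ?_
        rw [← inv_pow]
        refine pow_le_pow_left₀ (by positivity) ?_ 2
        rwa [hc, inv_inv]
      have hdecomp : v ξ * (c ^ 2 * k (c • ξ) * (‖ξ‖ * dnu u ξ))
          - u ξ * (c ^ 2 * k (c • ξ) * (‖ξ‖ * dnu v ξ))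
          = (c ^ 2 * ‖ξ‖ * k (c • ξ)) *
            (v ξ * (dnu u ξ - Complex.I * (kappa0 κ1 κ2 ξ : ℂ) * u ξ)
              - u ξ * (dnu v ξ - Complex.I * (kappa0 κ1 κ2 ξ : ℂ) * v ξ)) := by ring
      rw [hdecomp, norm_mul]
      have hb1 : ‖(c ^ 2 * ‖ξ‖ * k (c • ξ) : ℂ)‖ ≤ 2 * c * N := by
        have hkN := hN (c • ξ) (by
          rw [norm_smul, Real.norm_of_nonneg hn.le]; linarith)
        rw [norm_mul, norm_mul, norm_pow, Complex.norm_real, Complex.norm_real, norm_norm,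
          Real.norm_of_nonneg hn.le]
        refine mul_le_mul ?_ hkN (norm_nonneg _) (by positivity)
        nlinarith
      have hb2 : ‖v ξ * (dnu u ξ - Complex.I * (kappa0 κ1 κ2 ξ : ℂ) * u ξ)
              - u ξ * (dnu v ξ - Complex.I * (kappa0 κ1 κ2 ξ : ℂ) * v ξ)‖
            ≤ 2 * (C * C') * c ^ 2 := by
        refine (norm_sub_le _ _).trans ?_
        rw [norm_mul, norm_mul]
        have e1 := mul_le_mul hv1 hu2 (norm_nonneg _) (by positivity)
        have e2 := mul_le_mul hu1 hv2 (norm_nonneg _) (by positivity)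
        have e3 := mul_le_mul_of_nonneg_left hrp (by positivity : 0 ≤ C * C')
        nlinarith
      calc _ ≤ (2 * c * N) * (2 * (C * C') * c ^ 2) :=
            mul_le_mul hb1 hb2 (norm_nonneg _) (by positivity)
        _ = (4 * N * (C * C') * c) * c ^ 2 := by ring
        _ ≤ δ * c ^ 2 := mul_le_mul_of_nonneg_right hδn (sq_nonneg c)
    · have h0 : ∀ w, gradDot w (scaledCutoff c 0) ξ = 0 := fun w => by
        have : ∀ e, fderiv ℝ (scaledCutoff c 0) ξ e = 0 := fun e =>
          image_eq_zero_of_notMem_tsupport (f := fun ξ => fderiv ℝ (scaledCutoff c 0) ξ e)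
            fun h => hin (by simpa using (tsupport_fderiv_scaledCutoff_subset hn 0 e h).1)
        simp [gradDot, this]
      rw [← hgrad, ← hgrad, h0, h0, mul_zero, mul_zero, sub_zero, norm_zero]
      positivity

theorem HasLogSingularity.tendsto_norm_sub_mul {w : Pt → ℂ} {y : Pt} (hw : HasLogSingularity w y) :
    Tendsto (fun ξ => ‖ξ - y‖ * ‖w ξ‖) (𝓝[≠] y) (𝓝 0) := by
  obtain ⟨U, hU, hyU, h, hh, hwU⟩ := hw
  have hr : Tendsto (fun ξ : Pt => ‖ξ - y‖) (𝓝[≠] y) (𝓝[>] 0) := tendsto_norm_sub_self_nhdsNE y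
  have hr0 : Tendsto (fun ξ : Pt => ‖ξ - y‖) (𝓝[≠] y) (𝓝 0) := hr.mono_right nhdsWithin_le_nhds
  have hlog : Tendsto (fun ξ : Pt => Real.log ‖ξ - y‖ * ‖ξ - y‖) (𝓝[≠] y) (𝓝 0) := by
    simpa [Function.comp_def] using (tendsto_log_mul_rpow_nhdsGT_zero zero_lt_one).comp hr
  have hcont : Tendsto h (𝓝[≠] y) (𝓝 (h y)) :=
    (hh.continuousOn.continuousAt (hU.mem_nhds hyU)).tendsto.mono_left nhdsWithin_le_nhds
  have key : Tendsto (fun ξ : Pt =>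
      -((1 / (2 * π) : ℝ) : ℂ) * ((Real.log ‖ξ - y‖ * ‖ξ - y‖ : ℝ) : ℂ)
        + ((‖ξ - y‖ : ℝ) : ℂ) * h ξ) (𝓝[≠] y) (𝓝 0) := by
    have h1 := (Complex.continuous_ofReal.tendsto 0).comp hlog
    have h2 := (Complex.continuous_ofReal.tendsto 0).comp hr0
    simpa using (h1.const_mul (-((1 / (2 * π) : ℝ) : ℂ))).add (h2.mul hcont)
  refine (tendsto_zero_iff_norm_tendsto_zero.1 key).congr' ?_
  filter_upwards [nhdsWithin_le_nhds (hU.mem_nhds hyU), self_mem_nhdsWithin] with ξ h1 h2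
  have hξ : -((1 / (2 * π) : ℝ) : ℂ) * ((Real.log ‖ξ - y‖ * ‖ξ - y‖ : ℝ) : ℂ)
      + ((‖ξ - y‖ : ℝ) : ℂ) * h ξ = ((‖ξ - y‖ : ℝ) : ℂ) * w ξ := by
    rw [hwU ξ ⟨h1, h2⟩]
    push_cast
    ring
  rw [hξ, norm_mul, Complex.norm_real, norm_norm]

theorem notMem_tsupport_fderiv_scaledCutoff {c : ℝ} (hc : 0 < c) {a ξ : Pt}
    (h : c * ‖ξ - a‖ < 1 ∨ 2 < c * ‖ξ - a‖) (e : Pt) :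
    ξ ∉ tsupport (fun ξ => fderiv ℝ (scaledCutoff c a) ξ e) := fun hξ => by
  obtain ⟨h1, h2⟩ := tsupport_fderiv_scaledCutoff_subset hc a e hξ
  rcases h with h | h <;> linarith

theorem flux_sub {u v g h : Pt → ℂ} (hg : Differentiable ℝ g) (hh : Differentiable ℝ h)
    (hgi : Integrable (fun ξ => v ξ * gradDot u g ξ - u ξ * gradDot v g ξ))
    (hhi : Integrable (fun ξ => v ξ * gradDot u h ξ - u ξ * gradDot v h ξ)) :
    Integrable (fun ξ => v ξ * gradDot u (g - h) ξ - u ξ * gradDot v (g - h) ξ) ∧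
      flux u v (g - h) = flux u v g - flux u v h := by
  have key : (fun ξ => v ξ * gradDot u (g - h) ξ - u ξ * gradDot v (g - h) ξ) =
      fun ξ => (v ξ * gradDot u g ξ - u ξ * gradDot v g ξ)
        - (v ξ * gradDot u h ξ - u ξ * gradDot v h ξ) := funext fun ξ => by
    simp only [gradDot, fderiv_sub (hg ξ) (hh ξ), sub_apply]
    ring
  refine ⟨key ▸ hgi.sub hhi, ?_⟩
  rw [flux, key, integral_sub hgi hhi, flux, flux]

theorem measurable_kappa0 (κ1 κ2 : ℝ) : Measurable (kappa0 κ1 κ2) := by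
  have : MeasurableSet {ξ : Pt | 0 < ξ 1} := (isOpen_lt (by fun_prop) (by fun_prop)).measurableSet
  exact Measurable.ite this measurable_const measurable_const

theorem norm_kappa0_sq_le (κ1 κ2 : ℝ) (ξ : Pt) :
    ‖((kappa0 κ1 κ2 ξ : ℝ) : ℂ) ^ 2‖ ≤ κ1 ^ 2 + κ2 ^ 2 := by
  rw [norm_pow, Complex.norm_real, Real.norm_eq_abs, sq_abs, kappa0]
  split_ifs <;> nlinarith [sq_nonneg κ1, sq_nonneg κ2]

/-- The flux through a large circle around two point sources is the sum of the fluxes through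
small circles around them. -/
theorem flux_scaledCutoff_eq_add {u v q : Pt → ℂ} {x z : Pt} (hq : Measurable q) {B : ℝ}
    (hB : ∀ ξ, ‖q ξ‖ ≤ B)
    (husol : ∀ φ : Pt → ℂ, ContDiff ℝ (⊤ : ℕ∞) φ → HasCompactSupport φ →
      ∫ ξ, u ξ * (lap φ ξ + q ξ * φ ξ) = -φ x)
    (hvsol : ∀ φ : Pt → ℂ, ContDiff ℝ (⊤ : ℕ∞) φ → HasCompactSupport φ →
      ∫ ξ, v ξ * (lap φ ξ + q ξ * φ ξ) = -φ z)
    (hu : ContDiffOn ℝ 1 u {x}ᶜ) (hv : ContDiffOn ℝ 1 v {z}ᶜ) {R : ℝ} (hR : 0 < R)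
    (hx : ‖x‖ < R) (hz : ‖z‖ < R) (hxz : 2 < R * ‖x - z‖) :
    flux u v (scaledCutoff R⁻¹ 0) = flux u v (scaledCutoff R x) + flux u v (scaledCutoff R z) := by
  have hR' : 0 < R⁻¹ := inv_pos.2 hR
  have hx' : R⁻¹ * ‖x - 0‖ < 1 := by rwa [sub_zero, inv_mul_lt_one₀ hR]
  have hz' : R⁻¹ * ‖z - 0‖ < 1 := by rwa [sub_zero, inv_mul_lt_one₀ hR]
  have hzx : 2 < R * ‖z - x‖ := by rwa [norm_sub_rev]
  have hself : ∀ a : Pt, R * ‖a - a‖ < 1 := fun a => by simp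
  have hΩ : IsOpen ({x}ᶜ ∩ {z}ᶜ : Set Pt) := isOpen_compl_singleton.inter isOpen_compl_singleton
  have huΩ := hu.mono (Set.inter_subset_left (t := {z}ᶜ))
  have hvΩ := hv.mono (Set.inter_subset_right (s := {x}ᶜ))
  have hsub : ∀ {s : Set Pt}, x ∉ s → z ∉ s → s ⊆ {x}ᶜ ∩ {z}ᶜ := fun h1 h2 ξ hξ =>
    ⟨fun h => h1 (h ▸ hξ), fun h => h2 (h ▸ hξ)⟩
  have hsmooth : ∀ c a, ContDiff ℝ 1 (scaledCutoff c a) := fun c a =>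
    contDiff_infty.1 (contDiff_scaledCutoff c a) 1
  have hdiff : ∀ c a, Differentiable ℝ (scaledCutoff c a) := fun c a =>
    (hsmooth c a).differentiable one_ne_zero
  have hflux : ∀ {c : ℝ} {a : Pt}, 0 < c → (c * ‖x - a‖ < 1 ∨ 2 < c * ‖x - a‖) →
      (c * ‖z - a‖ < 1 ∨ 2 < c * ‖z - a‖) → Integrable (fun ξ =>
        v ξ * gradDot u (scaledCutoff c a) ξ - u ξ * gradDot v (scaledCutoff c a) ξ) :=
    fun hc h1 h2 => integrable_flux hΩ huΩ hvΩ (hsmooth _ _) (hasCompactSupport_scaledCutoff hc _)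
      fun e => hsub (notMem_tsupport_fderiv_scaledCutoff hc h1 e)
        (notMem_tsupport_fderiv_scaledCutoff hc h2 e)
  obtain ⟨hi, h1⟩ := flux_sub (hdiff _ _) (hdiff _ _) (hflux hR' (.inl hx') (.inl hz'))
    (hflux hR (.inl (hself x)) (.inr hzx))
  obtain ⟨-, h2⟩ := flux_sub ((hdiff _ _).sub (hdiff _ _)) (hdiff _ _) hi
    (hflux hR (.inr hxz) (.inl (hself z)))
  have hψx : x ∉ tsupport (scaledCutoff R⁻¹ 0 - scaledCutoff R x - scaledCutoff R z) := by
    rw [notMem_tsupport_iff_eventuallyEq]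
    filter_upwards [scaledCutoff_eventuallyEq_one hR' hx',
      scaledCutoff_eventuallyEq_one hR (hself x), scaledCutoff_eventuallyEq_zero hR hxz]
      with ξ e1 e2 e3
    simp [e1, e2, e3]
  have hψz : z ∉ tsupport (scaledCutoff R⁻¹ 0 - scaledCutoff R x - scaledCutoff R z) := by
    rw [notMem_tsupport_iff_eventuallyEq]
    filter_upwards [scaledCutoff_eventuallyEq_one hR' hz',
      scaledCutoff_eventuallyEq_zero hR hzx, scaledCutoff_eventuallyEq_one hR (hself z)]
      with ξ e1 e2 e3
    simp [e1, e2, e3]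
  have h0 := flux_eq_zero hΩ huΩ hvΩ hq hB
    (fun φ hφ hφc hφΩ => by
      rw [husol φ hφ hφc, image_eq_zero_of_notMem_tsupport fun h => (hφΩ h).1 rfl, neg_zero])
    (fun φ hφ hφc hφΩ => by
      rw [hvsol φ hφ hφc, image_eq_zero_of_notMem_tsupport fun h => (hφΩ h).2 rfl, neg_zero])
    (((hsmooth _ _).sub (hsmooth _ _)).sub (hsmooth _ _))
    (((hasCompactSupport_scaledCutoff hR' 0).sub (hasCompactSupport_scaledCutoff hR x)).sub
      (hasCompactSupport_scaledCutoff hR z)) (hsub hψx hψz)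
  linear_combination h0 - h2 - h1

/-- reciprocity of the two-layer Green's function G(x, z) = G(z, x). -/
theorem green_function_reciprocity
    (κ1 κ2 : ℝ) (hκ1 : 0 < κ1) (hκ2 : 0 < κ2)
    (G : Pt → Pt → ℂ)
    (hGloc : ∀ y : Pt, y 1 ≠ 0 → LocallyIntegrable (fun ξ => G ξ y) volume)
    (hGsol : ∀ y : Pt, y 1 ≠ 0 → IsPointSourceSol κ1 κ2 (fun ξ => G ξ y) y)
    (hGsing : ∀ y : Pt, y 1 ≠ 0 → HasLogSingularity (fun ξ => G ξ y) y)
    (hGreg : ∀ y : Pt, y 1 ≠ 0 → SourceRegular (fun ξ => G ξ y) y)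
    (hGrad : ∀ y : Pt, y 1 ≠ 0 → RadiationDecay κ1 κ2 (fun ξ => G ξ y))
    (x z : Pt) (hx2 : x 1 ≠ 0) (hz2 : z 1 ≠ 0) (hxz : x ≠ z) :
    G x z = G z x := by
  have hq : Measurable fun ξ => ((kappa0 κ1 κ2 ξ : ℝ) : ℂ) ^ 2 :=
    (Complex.measurable_ofReal.comp (measurable_kappa0 κ1 κ2)).pow_const 2
  have hB := norm_kappa0_sq_le κ1 κ2
  have hu := (hGreg x hx2).1
  have hv := (hGreg z hz2).1
  have hlx := tendsto_flux_scaledCutoff (hGloc x hx2) hq hB (hGsol x hx2) hu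
    (hGsing x hx2).tendsto_norm_sub_mul isOpen_compl_singleton hxz hv
  have hlz := tendsto_flux_scaledCutoff (hGloc z hz2) hq hB (hGsol z hz2) hv
    (hGsing z hz2).tendsto_norm_sub_mul isOpen_compl_singleton hxz.symm hu
  have hinf := tendsto_flux_scaledCutoff_of_radiationDecay (hGrad x hx2) (hGrad z hz2)
  have hnorm : 0 < ‖x - z‖ := norm_pos_iff.2 (sub_ne_zero.2 hxz)
  refine sub_eq_zero.1 (tendsto_nhds_unique (hlx.sub hlz) (hinf.congr' ?_))
  have hcast := tendsto_natCast_atTop_atTop (R := ℝ)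
  filter_upwards [hcast.eventually_gt_atTop 0, hcast.eventually_gt_atTop ‖x‖,
    hcast.eventually_gt_atTop ‖z‖, hcast.eventually_gt_atTop (2 / ‖x - z‖)] with n h1 h2 h3 h4
  rw [flux_scaledCutoff_eq_add hq hB (hGsol x hx2) (hGsol z hz2) hu hv h1 h2 h3
    ((div_lt_iff₀ hnorm).1 h4), flux_swap (fun ξ => G ξ x), sub_neg_eq_add]

end
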